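/- arXiv:1211.2532 — 5 statements merged into one kernel-verified Lean document; each statement's English description precedes it below -/
import Mathlib

section
/- Let p ≥ 1, let S be a p×p real symmetric matrix, let ρ > 0 and ζ > 0. Let Θ and Θ* be p×p real symmetric positive definite matrices, and suppose Θ* is a fixed point of the G-ISTA step, i.e. Θ* = η_{ζρ}(Θ* − ζ(S − Θ*⁻¹)). Set a = min(λ_min(Θ), λ_min(Θ*)) and b = max(λ_max(Θ), λ_max(Θ*)). Then ‖η_{ζρ}(Θ − ζ(S − Θ⁻¹)) − Θ*‖_F ≤ max{|1 − ζ/b²|, |1 − ζ/a²|} · ‖Θ − Θ*‖_F. -/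
open Matrix

/-- Entrywise soft-thresholding operator `η_c`. -/
noncomputable def softThresh {n : Type*} [Fintype n] (c : ℝ) (X : Matrix n n ℝ) :
    Matrix n n ℝ :=
  fun i j => Real.sign (X i j) * max (|X i j| - c) 0

/-- Frobenius norm of a real matrix. -/
noncomputable def frobNorm {n : Type*} [Fintype n] (A : Matrix n n ℝ) : ℝ :=
  Real.sqrt (∑ i, ∑ j, (A i j) ^ 2)

/-- Smallest eigenvalue of a real symmetric matrix (as the infimum of the
Rayleigh quotient over the unit sphere). -/
noncomputable def lmin {n : Type*} [Fintype n] (A : Matrix n n ℝ) : ℝ :=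
  ⨅ x : {x : n → ℝ // ∑ i, (x i) ^ 2 = 1}, x.1 ⬝ᵥ A.mulVec x.1

/-- Largest eigenvalue of a real symmetric matrix. -/
noncomputable def lmax {n : Type*} [Fintype n] (A : Matrix n n ℝ) : ℝ :=
  ⨆ x : {x : n → ℝ // ∑ i, (x i) ^ 2 = 1}, x.1 ⬝ᵥ A.mulVec x.1

/-- Spectral norm (largest singular value) of a real matrix. -/
noncomputable def specNorm {n : Type*} [Fintype n] (A : Matrix n n ℝ) : ℝ :=
  ⨆ x : {x : n → ℝ // ∑ i, (x i) ^ 2 = 1}, Real.sqrt (∑ i, (A.mulVec x.1 i) ^ 2)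

/-- Scalar soft-thresholding is nonexpansive. -/
theorem abs_sign_mul_max_sub_le {c : ℝ} (hc : 0 ≤ c) (x y : ℝ) :
    |Real.sign x * max (|x| - c) 0 - Real.sign y * max (|y| - c) 0| ≤ |x - y| := by
  have key : ∀ x : ℝ, Real.sign x * max (|x| - c) 0 = x - max (-c) (min c x) := by
    intro x
    rcases lt_trichotomy x 0 with h | h | h
    · rw [Real.sign_of_neg h, abs_of_neg h]; grind
    · subst h; simp [hc]
    · rw [Real.sign_of_pos h, abs_of_pos h]; grind
  rw [key, key]
  grind

theorem frobNorm_le_mul_of_abs_le {n : Type*} [Fintype n] {A B : Matrix n n ℝ} {C : ℝ}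
    (hC : 0 ≤ C) (h : ∀ i j, |A i j| ≤ C * |B i j|) : frobNorm A ≤ C * frobNorm B := by
  unfold frobNorm
  rw [← Real.sqrt_sq hC, ← Real.sqrt_mul (sq_nonneg C)]
  apply Real.sqrt_le_sqrt
  simp_rw [Finset.mul_sum]
  gcongr with i _ j _
  have := pow_le_pow_left₀ (abs_nonneg _) (h i j) 2
  rwa [sq_abs, mul_pow, sq_abs] at this

theorem frobNorm_eq_sqrt_trace {n : Type*} [Fintype n] (A : Matrix n n ℝ) :
    frobNorm A = Real.sqrt (Aᵀ * A).trace := by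
  unfold frobNorm
  rw [Finset.sum_comm]
  simp [Matrix.trace, Matrix.mul_apply, sq]

/-- The Frobenius norm is invariant under orthogonal transformations on both sides. -/
theorem frobNorm_orthogonal_mul_mul {n : Type*} [Fintype n] [DecidableEq n]
    {U V : Matrix n n ℝ} (hU : U * Uᵀ = 1) (hV : V * Vᵀ = 1) (A : Matrix n n ℝ) :
    frobNorm (Uᵀ * A * V) = frobNorm A := by
  rw [frobNorm_eq_sqrt_trace, frobNorm_eq_sqrt_trace]
  congr 1
  have h : (Uᵀ * A * V)ᵀ * (Uᵀ * A * V) = Vᵀ * (Aᵀ * (U * Uᵀ) * A * V) := by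
    simp only [Matrix.transpose_mul, Matrix.transpose_transpose, Matrix.mul_assoc]
  rw [h, Matrix.trace_mul_comm, Matrix.mul_assoc, hV, hU, Matrix.mul_one, Matrix.mul_one]

/-- Spectral decomposition of a positive definite matrix, with its eigenvalues between
the extreme values of the Rayleigh quotient. -/
theorem Matrix.PosDef.exists_orthogonal_diagonalization {n : Type*} [Fintype n] [DecidableEq n]
    [Nonempty n] {A : Matrix n n ℝ} (hA : A.PosDef) :
    ∃ (U : Matrix n n ℝ) (d : n → ℝ), U * Uᵀ = 1 ∧ A = U * diagonal d * Uᵀ ∧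
      0 < lmin A ∧ ∀ i, lmin A ≤ d i ∧ d i ≤ lmax A := by
  set U : Matrix n n ℝ := (hA.isHermitian.eigenvectorUnitary : Matrix n n ℝ)
  set d : n → ℝ := hA.isHermitian.eigenvalues
  have hUU : U * Uᵀ = 1 := by
    simpa [Matrix.star_eq_conjTranspose] using
      Unitary.coe_mul_star_self hA.isHermitian.eigenvectorUnitary
  have hUU' : Uᵀ * U = 1 := mul_eq_one_comm.mp hUU
  have hdec : A = U * diagonal d * Uᵀ := by
    have h := hA.isHermitian.spectral_theorem
    rw [Unitary.conjStarAlgAut_apply] at h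
    simpa [Matrix.star_eq_conjTranspose] using h
  have hd : ∀ i, 0 < d i := hA.eigenvalues_pos
  have hquad : ∀ x : n → ℝ, x ⬝ᵥ A *ᵥ x = ∑ i, d i * (Uᵀ *ᵥ x) i ^ 2 := by
    intro x
    rw [hdec, ← Matrix.mulVec_mulVec, ← Matrix.mulVec_mulVec, Matrix.dotProduct_mulVec,
      ← Matrix.mulVec_transpose]
    simp only [dotProduct, Matrix.mulVec_diagonal]
    exact Finset.sum_congr rfl fun i _ => by ring
  have hnorm : ∀ x : n → ℝ, ∑ i, (Uᵀ *ᵥ x) i ^ 2 = ∑ i, x i ^ 2 := by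
    intro x
    have h : (Uᵀ *ᵥ x) ⬝ᵥ (Uᵀ *ᵥ x) = x ⬝ᵥ x := by
      rw [Matrix.dotProduct_mulVec, Matrix.vecMul_transpose, Matrix.mulVec_mulVec, hUU,
        Matrix.one_mulVec]
    simpa [dotProduct, sq] using h
  obtain ⟨i₀, hi₀⟩ := Finite.exists_min d
  obtain ⟨i₁, hi₁⟩ := Finite.exists_max d
  have hlow : ∀ x : {x : n → ℝ // ∑ i, (x i) ^ 2 = 1}, d i₀ ≤ x.1 ⬝ᵥ A.mulVec x.1 := by
    rintro ⟨x, hx⟩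
    change d i₀ ≤ x ⬝ᵥ A *ᵥ x
    rw [hquad, ← mul_one (d i₀), ← hx, ← hnorm x, Finset.mul_sum]
    gcongr with i _
    exact hi₀ i
  have hup : ∀ x : {x : n → ℝ // ∑ i, (x i) ^ 2 = 1}, x.1 ⬝ᵥ A.mulVec x.1 ≤ d i₁ := by
    rintro ⟨x, hx⟩
    change x ⬝ᵥ A *ᵥ x ≤ d i₁
    rw [hquad, ← mul_one (d i₁), ← hx, ← hnorm x, Finset.mul_sum]
    gcongr with i _
    exact hi₁ i
  have hev : ∀ i, ∃ x : {x : n → ℝ // ∑ i, (x i) ^ 2 = 1}, x.1 ⬝ᵥ A.mulVec x.1 = d i := by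
    intro i
    have h : Uᵀ *ᵥ (U *ᵥ Pi.single i 1) = Pi.single i 1 := by
      rw [Matrix.mulVec_mulVec, hUU', Matrix.one_mulVec]
    refine ⟨⟨U *ᵥ Pi.single i 1, ?_⟩, ?_⟩
    · rw [← hnorm, h]
      simp [Pi.single_apply]
    · rw [hquad, h]
      simp [Pi.single_apply]
  have : Nonempty {x : n → ℝ // ∑ i, (x i) ^ 2 = 1} := ⟨(hev i₀).choose⟩
  refine ⟨U, d, hUU, hdec, (hd i₀).trans_le (le_ciInf hlow), fun i => ?_⟩
  obtain ⟨x, hx⟩ := hev i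
  rw [← hx]
  exact ⟨ciInf_le ⟨d i₀, Set.forall_mem_range.2 hlow⟩ x,
    le_ciSup (f := fun x : {x : n → ℝ // ∑ i, (x i) ^ 2 = 1} => x.1 ⬝ᵥ A.mulVec x.1)
      ⟨d i₁, Set.forall_mem_range.2 hup⟩ x⟩

theorem abs_one_sub_div_mul_le_max {ζ a b s t : ℝ} (hζ : 0 ≤ ζ) (ha : 0 < a)
    (has : a ≤ s) (hat : a ≤ t) (hsb : s ≤ b) (htb : t ≤ b) :
    |1 - ζ / (s * t)| ≤ max |1 - ζ / b ^ 2| |1 - ζ / a ^ 2| := by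
  have hs := ha.trans_le has
  have ht := ha.trans_le hat
  have h₁ : ζ / b ^ 2 ≤ ζ / (s * t) := by
    rw [sq]
    gcongr
    exact hs.le.trans hsb
  have h₂ : ζ / (s * t) ≤ ζ / a ^ 2 := by
    rw [sq]
    gcongr
  rw [max_comm]
  exact abs_le_max_abs_abs (by linarith) (by linarith)

/-- The gradient step `X ↦ X + ζ X⁻¹` is Lipschitz on positive definite matrices. -/
theorem frobNorm_sub_add_smul_inv_sub_le {n : Type*} [Fintype n] [DecidableEq n] [Nonempty n]
    {ζ : ℝ} (hζ : 0 ≤ ζ) {A B : Matrix n n ℝ} (hA : A.PosDef) (hB : B.PosDef) :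
    frobNorm (A - B + ζ • (A⁻¹ - B⁻¹)) ≤
      max |1 - ζ / (max (lmax A) (lmax B)) ^ 2| |1 - ζ / (min (lmin A) (lmin B)) ^ 2| *
        frobNorm (A - B) := by
  obtain ⟨U, d, hU, hAd, hA₀, hd⟩ := hA.exists_orthogonal_diagonalization
  obtain ⟨V, e, hV, hBe, hB₀, he⟩ := hB.exists_orthogonal_diagonalization
  have hU' : Uᵀ * U = 1 := mul_eq_one_comm.mp hU
  have hV' : Vᵀ * V = 1 := mul_eq_one_comm.mp hV
  have hUA : Uᵀ * A = diagonal d * Uᵀ := by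
    rw [hAd, ← Matrix.mul_assoc, ← Matrix.mul_assoc, hU', Matrix.one_mul]
  have hBV : B * V = V * diagonal e := by
    rw [hBe, Matrix.mul_assoc, hV', Matrix.mul_one]
  have hinv : A * (A⁻¹ - B⁻¹) * B = -(A - B) := by
    rw [Matrix.mul_sub, Matrix.sub_mul, Matrix.mul_nonsing_inv _ hA.det_pos.ne'.isUnit,
      Matrix.mul_assoc A, Matrix.nonsing_inv_mul _ hB.det_pos.ne'.isUnit]
    simp
  have hdiag : diagonal d * (Uᵀ * (A⁻¹ - B⁻¹) * V) * diagonal e = -(Uᵀ * (A - B) * V) := by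
    calc diagonal d * (Uᵀ * (A⁻¹ - B⁻¹) * V) * diagonal e
        = (diagonal d * Uᵀ) * (A⁻¹ - B⁻¹) * (V * diagonal e) := by
          simp only [Matrix.mul_assoc]
      _ = Uᵀ * (A * (A⁻¹ - B⁻¹) * B) * V := by
          rw [← hUA, ← hBV]
          simp only [Matrix.mul_assoc]
      _ = _ := by rw [hinv, Matrix.mul_neg, Matrix.neg_mul]
  rw [← frobNorm_orthogonal_mul_mul hU hV (A - B),
    ← frobNorm_orthogonal_mul_mul hU hV (A - B + ζ • (A⁻¹ - B⁻¹))]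
  refine frobNorm_le_mul_of_abs_le (le_max_of_le_left (abs_nonneg _)) fun i j => ?_
  have hij := congrFun (congrFun hdiag i) j
  rw [Matrix.mul_diagonal, Matrix.diagonal_mul, Matrix.neg_apply] at hij
  rw [Matrix.mul_add, Matrix.add_mul, Matrix.mul_smul, Matrix.smul_mul, Matrix.add_apply,
    Matrix.smul_apply, smul_eq_mul]
  have hdi := hA₀.trans_le (hd i).1
  have hej := hB₀.trans_le (he j).1
  have hfac : (Uᵀ * (A - B) * V) i j + ζ * (Uᵀ * (A⁻¹ - B⁻¹) * V) i j =
      (1 - ζ / (d i * e j)) * (Uᵀ * (A - B) * V) i j := by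
    rw [eq_neg_iff_add_eq_zero] at hij
    field_simp
    linear_combination ζ * hij
  rw [hfac, abs_mul]
  gcongr
  exact abs_one_sub_div_mul_le_max hζ (lt_min hA₀ hB₀) ((min_le_left _ _).trans (hd i).1)
    ((min_le_right _ _).trans (he j).1) ((hd i).2.trans (le_max_left _ _))
    ((he j).2.trans (le_max_right _ _))

/-- One G-ISTA step is a contraction towards any fixed point, with contraction
factor `max |1 - ζ/b²| |1 - ζ/a²|` where `a = min(λmin Θ, λmin Θ*)` and
`b = max(λmax Θ, λmax Θ*)`. -/
theorem gista_step_contraction {p : ℕ} (hp : 0 < p)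
    (S : Matrix (Fin p) (Fin p) ℝ) (hS : S.IsSymm)
    (ρ ζ : ℝ) (hρ : 0 < ρ) (hζ : 0 < ζ)
    (Θ Θs : Matrix (Fin p) (Fin p) ℝ) (hΘ : Θ.PosDef) (hΘs : Θs.PosDef)
    (hfix : Θs = softThresh (ζ * ρ) (Θs - ζ • (S - Θs⁻¹))) :
    frobNorm (softThresh (ζ * ρ) (Θ - ζ • (S - Θ⁻¹)) - Θs) ≤
      max |1 - ζ / (max (lmax Θ) (lmax Θs)) ^ 2|
          |1 - ζ / (min (lmin Θ) (lmin Θs)) ^ 2| * frobNorm (Θ - Θs) := by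
  have : Nonempty (Fin p) := ⟨⟨0, hp⟩⟩
  conv_lhs => rw [hfix]
  refine le_trans ?_ (frobNorm_sub_add_smul_inv_sub_le hζ.le hΘ hΘs)
  rw [← one_mul (frobNorm (Θ - Θs + _))]
  refine frobNorm_le_mul_of_abs_le zero_le_one fun i j => ?_
  have h : (Θ - Θs + ζ • (Θ⁻¹ - Θs⁻¹)) i j =
      (Θ - ζ • (S - Θ⁻¹)) i j - (Θs - ζ • (S - Θs⁻¹)) i j := by
    simp only [Matrix.add_apply, Matrix.sub_apply, Matrix.smul_apply, smul_eq_mul]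
    ring
  rw [one_mul, h]
  exact abs_sign_mul_max_sub_le (mul_pos hζ hρ).le _ _
end

section
/- Let p ≥ 1, let S be a p×p real symmetric positive semidefinite matrix and let ρ > 0. If Θ* is a p×p real symmetric positive definite matrix that minimizes F(Θ) = −log det Θ + Tr(SΘ) + ρ·Σ_{i,j}|Θ_{ij}| over all p×p real symmetric positive definite matrices, then αI ⪯ Θ*, where α = 1/(‖S‖₂ + pρ). -/
open Matrix

/-- The unit-sphere bound for the spectral norm, in homogeneous form. -/
theorem dotProduct_mulVec_le_specNorm {n : Type*} [Fintype n] (A : Matrix n n ℝ) (v : n → ℝ) :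
    v ⬝ᵥ A *ᵥ v ≤ specNorm A * (v ⬝ᵥ v) := by
  have hbdd : BddAbove (Set.range fun x : {x : n → ℝ // ∑ i, (x i) ^ 2 = 1} =>
      Real.sqrt (∑ i, (A.mulVec x.1 i) ^ 2)) := by
    refine ⟨Real.sqrt (∑ i, ∑ j, A i j ^ 2), ?_⟩
    rintro _ ⟨x, rfl⟩
    refine Real.sqrt_le_sqrt (Finset.sum_le_sum fun i _ => ?_)
    have h := Finset.sum_mul_sq_le_sq_mul_sq Finset.univ (A i) x.1
    rwa [x.2, mul_one] at h
  have hunit : ∀ x : n → ℝ, ∑ i, x i ^ 2 = 1 → x ⬝ᵥ A *ᵥ x ≤ specNorm A := fun x hx => by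
    have h := Real.sum_mul_le_sqrt_mul_sqrt Finset.univ x (A *ᵥ x)
    rw [hx, Real.sqrt_one, one_mul] at h
    exact h.trans (le_ciSup hbdd ⟨x, hx⟩)
  have hsq : v ⬝ᵥ v = ∑ i, v i ^ 2 := Finset.sum_congr rfl fun i _ => (sq (v i)).symm
  obtain rfl | hv := eq_or_ne v 0
  · simp
  have hpos : 0 < v ⬝ᵥ v := by simpa using Matrix.dotProduct_star_self_pos_iff.2 hv
  set r := Real.sqrt (v ⬝ᵥ v) with hr
  have hr2 : r ^ 2 = v ⬝ᵥ v := Real.sq_sqrt hpos.le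
  have hr0 : r ≠ 0 := (Real.sqrt_pos.2 hpos).ne'
  have h := hunit (r⁻¹ • v) (by
    simp only [Pi.smul_apply, smul_eq_mul, mul_pow, ← Finset.mul_sum, ← hsq, ← hr2]
    field_simp)
  simp only [Matrix.mulVec_smul, smul_dotProduct, dotProduct_smul, smul_eq_mul] at h
  rw [← hr2]
  calc v ⬝ᵥ A *ᵥ v = r⁻¹ * (r⁻¹ * (v ⬝ᵥ A *ᵥ v)) * r ^ 2 := by field_simp
    _ ≤ specNorm A * r ^ 2 := by gcongr

theorem specNorm_nonneg {n : Type*} [Fintype n] (A : Matrix n n ℝ) : 0 ≤ specNorm A :=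
  Real.iSup_nonneg fun _ => Real.sqrt_nonneg _

/-- The matrix determinant lemma for a scaled rank-one update. -/
theorem det_add_smul_vecMulVec {n : Type*} [Fintype n] [DecidableEq n] {A : Matrix n n ℝ}
    (hA : IsUnit A.det) (t : ℝ) (v : n → ℝ) :
    (A + t • vecMulVec v v).det = A.det * (1 + t * (v ⬝ᵥ A⁻¹ *ᵥ v)) := by
  have h := Matrix.det_add_replicateCol_mul_replicateRow (ι := Unit) hA (t • v) v
  rw [← vecMulVec_eq, smul_vecMulVec] at h
  rw [h, det_unique (n := Unit), Matrix.add_apply, one_apply_eq, Matrix.mul_assoc, ← replicateCol_mulVec,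
    replicateRow_mul_replicateCol_apply, mulVec_smul, dotProduct_smul, smul_eq_mul]

/-- A rank-one update increases the entrywise `ℓ¹` norm by at most `card n` times its size. -/
theorem sum_abs_add_smul_vecMulVec_le {n : Type*} [Fintype n] (A : Matrix n n ℝ) {t : ℝ}
    (ht : 0 ≤ t) (v : n → ℝ) :
    ∑ i, ∑ j, |(A + t • vecMulVec v v) i j| ≤
      ∑ i, ∑ j, |A i j| + t * (Fintype.card n * (v ⬝ᵥ v)) := by
  have hcs : (∑ i, |v i|) ^ 2 ≤ Fintype.card n * (v ⬝ᵥ v) := by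
    simpa [dotProduct, sq] using sq_sum_le_card_mul_sum_sq (s := Finset.univ) (f := fun i => |v i|)
  calc ∑ i, ∑ j, |(A + t • vecMulVec v v) i j|
      ≤ ∑ i, ∑ j, (|A i j| + t * (|v i| * |v j|)) := by
        refine Finset.sum_le_sum fun i _ => Finset.sum_le_sum fun j _ => ?_
        refine (abs_add_le _ _).trans_eq ?_
        simp [vecMulVec_apply, abs_mul, abs_of_nonneg ht]
    _ = ∑ i, ∑ j, |A i j| + t * (∑ i, |v i|) ^ 2 := by
        simp only [Finset.sum_add_distrib, ← Finset.mul_sum, ← Finset.sum_mul, sq]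
    _ ≤ _ := by gcongr

/-- If `A⁻¹ ⪯ c I` then `c⁻¹ I ⪯ A`. -/
theorem posSemidef_sub_smul_one {n : Type*} [Fintype n] [DecidableEq n] {A : Matrix n n ℝ}
    (hA : A.PosDef) {c : ℝ} (hc : 0 < c) (h : ∀ v, v ⬝ᵥ A⁻¹ *ᵥ v ≤ c * (v ⬝ᵥ v)) :
    (A - (1 / c) • 1).PosSemidef := by
  refine .of_dotProduct_mulVec_nonneg (hA.isHermitian.sub (by simp [IsHermitian])) fun v => ?_
  have hu : IsUnit A.det := hA.det_pos.ne'.isUnit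
  have hAT : Aᵀ = A := by simpa using hA.isHermitian.eq
  have hcomm : (A⁻¹ *ᵥ v) ⬝ᵥ A *ᵥ v = v ⬝ᵥ v := by
    rw [dotProduct_mulVec, ← mulVec_transpose, hAT, mulVec_mulVec, mul_nonsing_inv _ hu, one_mulVec]
  have h0 := hA.posSemidef.dotProduct_mulVec_nonneg (v - (1 / c) • A⁻¹ *ᵥ v)
  simp only [star_trivial, mulVec_sub, mulVec_smul, mulVec_mulVec, mul_nonsing_inv _ hu,
    one_mulVec, sub_dotProduct, dotProduct_sub, smul_dotProduct, dotProduct_smul, smul_eq_mul,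
    hcomm, dotProduct_comm (A⁻¹ *ᵥ v) v] at h0
  have h1 : 1 / c * (1 / c * (v ⬝ᵥ A⁻¹ *ᵥ v)) ≤ 1 / c * (v ⬝ᵥ v) := by
    have := mul_le_mul_of_nonneg_left (h v) (by positivity : 0 ≤ 1 / c * (1 / c))
    refine (mul_assoc _ _ _).symm.trans_le (this.trans_eq ?_)
    field_simp
  simp only [star_trivial, sub_mulVec, smul_mulVec, one_mulVec, dotProduct_sub, dotProduct_smul,
    smul_eq_mul]
  linarith

/-- If `log (1 + t q) ≤ t b` for all positive `t`, then `q ≤ b`. -/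
theorem le_of_forall_log_one_add_mul_le {q b : ℝ} (hq : 0 ≤ q)
    (h : ∀ t, 0 < t → Real.log (1 + t * q) ≤ t * b) : q ≤ b := by
  have hle : ∀ t, 0 < t → q ≤ b * (1 + t * q) := fun t ht => by
    have hpos : 0 < 1 + t * q := by positivity
    have h1 := (Real.one_sub_inv_le_log_of_pos hpos).trans (h t ht)
    have h2 : t * q ≤ t * (b * (1 + t * q)) := by
      have := mul_le_mul_of_nonneg_right h1 hpos.le
      rw [sub_mul, inv_mul_cancel₀ hpos.ne'] at this
      linarith
    exact le_of_mul_le_mul_left h2 ht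
  have hlim : Filter.Tendsto (fun t : ℝ => b * (1 + t * q)) (nhdsWithin 0 (Set.Ioi 0)) (nhds b) := by
    have : Continuous fun t : ℝ => b * (1 + t * q) := by fun_prop
    simpa using (this.tendsto 0).mono_left nhdsWithin_le_nhds
  exact ge_of_tendsto hlim (Filter.eventually_of_mem self_mem_nhdsWithin hle)

/-- Lower eigenvalue bound for the minimizer of the ℓ1-penalized negative
Gaussian log-likelihood: `αI ⪯ Θ*` with `α = 1/(‖S‖₂ + pρ)`. -/
theorem optimal_point_lower_bound {p : ℕ} (hp : 0 < p)
    (S : Matrix (Fin p) (Fin p) ℝ) (hS : S.PosSemidef)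
    (ρ : ℝ) (hρ : 0 < ρ)
    (F : Matrix (Fin p) (Fin p) ℝ → ℝ)
    (hF : ∀ Θ, F Θ = -Real.log Θ.det + (S * Θ).trace + ρ * ∑ i, ∑ j, |Θ i j|)
    (Θs : Matrix (Fin p) (Fin p) ℝ) (hΘs : Θs.PosDef)
    (hmin : ∀ Θ : Matrix (Fin p) (Fin p) ℝ, Θ.PosDef → F Θs ≤ F Θ) :
    (Θs - (1 / (specNorm S + p * ρ)) • 1).PosSemidef := by
  have hc : 0 < specNorm S + p * ρ :=
    add_pos_of_nonneg_of_pos (specNorm_nonneg S) (mul_pos (Nat.cast_pos.2 hp) hρ)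
  refine posSemidef_sub_smul_one hΘs hc fun v => ?_
  have hq : 0 ≤ v ⬝ᵥ Θs⁻¹ *ᵥ v := by
    simpa using hΘs.inv.posSemidef.dotProduct_mulVec_nonneg v
  refine le_of_forall_log_one_add_mul_le hq fun t ht => ?_
  have hpd : (Θs + t • vecMulVec v v).PosDef :=
    hΘs.add_posSemidef ((by simpa using posSemidef_vecMulVec_self_star v :
      (vecMulVec v v).PosSemidef).smul ht.le)
  have hF_le := hmin _ hpd
  have hpos : 0 < 1 + t * (v ⬝ᵥ Θs⁻¹ *ᵥ v) := by positivity
  have htr : (S * (Θs + t • vecMulVec v v)).trace = (S * Θs).trace + t * (v ⬝ᵥ S *ᵥ v) := by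
    rw [Matrix.mul_add, trace_add, Matrix.mul_smul, trace_smul, mul_vecMulVec, trace_vecMulVec,
      dotProduct_comm, smul_eq_mul]
  rw [hF, hF, det_add_smul_vecMulVec hΘs.det_pos.ne'.isUnit,
    Real.log_mul hΘs.det_pos.ne' hpos.ne', htr] at hF_le
  have hl1 := mul_le_mul_of_nonneg_left (sum_abs_add_smul_vecMulVec_le Θs ht.le v) hρ.le
  have hS_le := mul_le_mul_of_nonneg_left (dotProduct_mulVec_le_specNorm S v) ht.le
  rw [Fintype.card_fin] at hl1
  linarith
end

section
/- Let 0 < a < b, let ζ > 0, let S be a p×p real symmetric matrix, and let Θ be a p×p real symmetric positive definite matrix with aI ⪯ Θ ⪯ bI. Then λ_min(Θ − ζ(S − Θ⁻¹)) ≥ 2√ζ − ζ·λ_max(S) if a ≤ √ζ ≤ b, and λ_min(Θ − ζ(S − Θ⁻¹)) ≥ min(a + ζ/a, b + ζ/b) − ζ·λ_max(S) otherwise. -/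
open Matrix

/-- The quadratic form of a real matrix is bounded above on the Euclidean unit sphere. -/
theorem bddAbove_quadForm_sphere {n : Type*} [Fintype n] (A : Matrix n n ℝ) :
    BddAbove (Set.range fun x : {x : n → ℝ // ∑ i, (x i) ^ 2 = 1} => x.1 ⬝ᵥ A.mulVec x.1) := by
  refine ⟨∑ i, ∑ j, |A i j|, ?_⟩
  rintro _ ⟨⟨x, hx⟩, rfl⟩
  have hx1 (i : n) : |x i| ≤ 1 := by
    rw [← sq_le_one_iff_abs_le_one, ← hx]
    exact Finset.single_le_sum (f := fun i => (x i) ^ 2) (fun j _ => sq_nonneg (x j))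
      (Finset.mem_univ i)
  simp only [dotProduct, mulVec, Finset.mul_sum]
  refine Finset.sum_le_sum fun i _ => Finset.sum_le_sum fun j _ => ?_
  calc x i * (A i j * x j) ≤ |x i| * (|A i j| * |x j|) := by
        rw [← abs_mul, ← abs_mul]; exact le_abs_self _
    _ ≤ 1 * (|A i j| * 1) := by gcongr <;> exact hx1 _
    _ = |A i j| := by ring

theorem quadForm_le_lmax {n : Type*} [Fintype n] (A : Matrix n n ℝ) {x : n → ℝ}
    (hx : ∑ i, (x i) ^ 2 = 1) : x ⬝ᵥ A.mulVec x ≤ lmax A :=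
  le_ciSup (bddAbove_quadForm_sphere A) ⟨x, hx⟩

theorem le_lmin {n : Type*} [Fintype n] [Nonempty n] {A : Matrix n n ℝ} {c : ℝ}
    (h : ∀ x : n → ℝ, ∑ i, (x i) ^ 2 = 1 → c ≤ x ⬝ᵥ A.mulVec x) : c ≤ lmin A := by
  classical
  have : Nonempty {x : n → ℝ // ∑ i, (x i) ^ 2 = 1} :=
    ⟨⟨Pi.single (Classical.arbitrary n) 1, by simp [Pi.single_apply]⟩⟩
  exact le_ciInf fun x => h x.1 x.2

/-- Cauchy–Schwarz for the forms of a positive definite matrix and its inverse. -/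
theorem Matrix.PosDef.inv_quadForm_le_quadForm_inv {n : Type*} [Fintype n] [DecidableEq n]
    {A : Matrix n n ℝ} (hA : A.PosDef) {x : n → ℝ} (hx : x ⬝ᵥ x = 1) :
    (x ⬝ᵥ A.mulVec x)⁻¹ ≤ x ⬝ᵥ A⁻¹.mulVec x := by
  set t := x ⬝ᵥ A.mulVec x with ht
  have hx0 : x ≠ 0 := by rintro rfl; simp at hx
  have ht0 : 0 < t := by simpa using hA.dotProduct_mulVec_pos hx0
  have hu : IsUnit A.det := A.isUnit_iff_isUnit_det.mp hA.isUnit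
  have hAinv : A.mulVec (A⁻¹.mulVec x) = x := by
    rw [mulVec_mulVec, mul_nonsing_inv _ hu, one_mulVec]
  have hsymm : (A⁻¹.mulVec x) ⬝ᵥ A.mulVec x = 1 := by
    have hAt : Aᵀ = A := by simpa using hA.isHermitian.eq
    rw [dotProduct_mulVec, ← mulVec_transpose, hAt, hAinv, hx]
  have hy : 0 ≤ (A⁻¹.mulVec x - t⁻¹ • x) ⬝ᵥ A.mulVec (A⁻¹.mulVec x - t⁻¹ • x) := by
    simpa using hA.posSemidef.dotProduct_mulVec_nonneg (A⁻¹.mulVec x - t⁻¹ • x)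
  have hexp : (A⁻¹.mulVec x - t⁻¹ • x) ⬝ᵥ A.mulVec (A⁻¹.mulVec x - t⁻¹ • x) =
      x ⬝ᵥ A⁻¹.mulVec x - t⁻¹ := by
    rw [mulVec_sub, mulVec_smul, hAinv]
    simp only [sub_dotProduct, dotProduct_sub, smul_dotProduct, dotProduct_smul, smul_eq_mul,
      hsymm, hx, ← ht]
    rw [dotProduct_comm]
    field_simp
    ring
  linarith

theorem two_mul_sqrt_le_add_div {ζ t : ℝ} (hζ : 0 ≤ ζ) (ht : 0 < t) :
    2 * Real.sqrt ζ ≤ t + ζ / t := by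
  have h : t + ζ / t - 2 * Real.sqrt ζ = (t - Real.sqrt ζ) ^ 2 / t := by
    field_simp
    linear_combination -Real.sq_sqrt hζ
  have : 0 ≤ (t - Real.sqrt ζ) ^ 2 / t := by positivity
  linarith

theorem add_div_sub_add_div {ζ s t : ℝ} (hs : s ≠ 0) (ht : t ≠ 0) :
    t + ζ / t - (s + ζ / s) = (t - s) * (t * s - ζ) / (t * s) := by
  field_simp
  ring

/-- Off the range of the minimiser `√ζ`, the map `t ↦ t + ζ / t` is monotone or antitone on
`[a, b]`, so it is minimised at an endpoint. -/
theorem min_endpoints_le_add_div {a b ζ t : ℝ} (ha : 0 < a) (hζ : 0 ≤ ζ)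
    (hat : a ≤ t) (htb : t ≤ b) (h : ¬ (a ≤ Real.sqrt ζ ∧ Real.sqrt ζ ≤ b)) :
    min (a + ζ / a) (b + ζ / b) ≤ t + ζ / t := by
  have ht : 0 < t := ha.trans_le hat
  have hb : 0 < b := ht.trans_le htb
  have hsq := Real.mul_self_sqrt hζ
  have hs := Real.sqrt_nonneg ζ
  rcases lt_or_ge (Real.sqrt ζ) a with hlt | hge
  · refine (min_le_left _ _).trans (sub_nonneg.mp ?_)
    rw [add_div_sub_add_div ha.ne' ht.ne']
    have : ζ ≤ t * a := by nlinarith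
    exact div_nonneg (mul_nonneg (sub_nonneg.mpr hat) (sub_nonneg.mpr this)) (by positivity)
  · have hlt : b < Real.sqrt ζ := not_le.mp fun hle => h ⟨hge, hle⟩
    refine (min_le_right _ _).trans (sub_nonneg.mp ?_)
    rw [add_div_sub_add_div hb.ne' ht.ne']
    have : t * b ≤ ζ := by nlinarith
    exact div_nonneg (mul_nonneg_of_nonpos_of_nonpos (sub_nonpos.mpr htb) (sub_nonpos.mpr this))
      (by positivity)

/-- A lower bound for `t + ζ / t` on `[a, b]` gives one for the smallest eigenvalue of the
gradient step at any `Θ` with spectrum in `[a, b]`. -/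
theorem sub_mul_lmax_le_lmin_gradient_step {n : Type*} [Fintype n] [DecidableEq n] [Nonempty n]
    {a b ζ c : ℝ} (hζ : 0 ≤ ζ) (S : Matrix n n ℝ) {Θ : Matrix n n ℝ} (hΘ : Θ.PosDef)
    (hla : (Θ - a • 1).PosSemidef) (hlb : (b • 1 - Θ).PosSemidef)
    (hc : ∀ t, a ≤ t → t ≤ b → c ≤ t + ζ / t) :
    c - ζ * lmax S ≤ lmin (Θ - ζ • (S - Θ⁻¹)) := by
  refine le_lmin fun x hx => ?_
  have hxx : x ⬝ᵥ x = 1 := by simpa [dotProduct, sq] using hx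
  have h1 : a ≤ x ⬝ᵥ Θ.mulVec x := by
    simpa [sub_mulVec, smul_mulVec, hxx] using hla.dotProduct_mulVec_nonneg x
  have h2 : x ⬝ᵥ Θ.mulVec x ≤ b := by
    simpa [sub_mulVec, smul_mulVec, hxx] using hlb.dotProduct_mulVec_nonneg x
  have h3 := mul_le_mul_of_nonneg_left (hΘ.inv_quadForm_le_quadForm_inv hxx) hζ
  have h4 := mul_le_mul_of_nonneg_left (quadForm_le_lmax S hx) hζ
  have h5 := hc _ h1 h2
  rw [div_eq_mul_inv] at h5
  simp only [sub_mulVec, smul_mulVec, dotProduct_sub, dotProduct_smul, smul_eq_mul]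
  linarith

/-- Lower bound on the smallest eigenvalue of the gradient step
`Θ − ζ(S − Θ⁻¹)` when `aI ⪯ Θ ⪯ bI`. -/
theorem gradient_step_lmin_bound {p : ℕ} (hp : 0 < p)
    (a b ζ : ℝ) (ha : 0 < a) (hab : a < b) (hζ : 0 < ζ)
    (S : Matrix (Fin p) (Fin p) ℝ) (hS : S.IsSymm)
    (Θ : Matrix (Fin p) (Fin p) ℝ) (hΘ : Θ.PosDef)
    (hla : (Θ - a • 1).PosSemidef) (hlb : (b • 1 - Θ).PosSemidef) :
    (a ≤ Real.sqrt ζ ∧ Real.sqrt ζ ≤ b →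
      2 * Real.sqrt ζ - ζ * lmax S ≤ lmin (Θ - ζ • (S - Θ⁻¹))) ∧
    (¬ (a ≤ Real.sqrt ζ ∧ Real.sqrt ζ ≤ b) →
      min (a + ζ / a) (b + ζ / b) - ζ * lmax S ≤ lmin (Θ - ζ • (S - Θ⁻¹))) := by
  have : Nonempty (Fin p) := ⟨⟨0, hp⟩⟩
  exact ⟨fun _ => sub_mul_lmax_le_lmin_gradient_step hζ.le S hΘ hla hlb fun _ hat _ =>
      two_mul_sqrt_le_add_div hζ.le (ha.trans_le hat),
    fun h => sub_mul_lmax_le_lmin_gradient_step hζ.le S hΘ hla hlb fun _ hat htb =>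
      min_endpoints_le_add_div ha hζ.le hat htb h⟩
end

section
/- Let 0 < a < b, let ζ > 0, let S be a p×p real symmetric matrix, and let Θ be a p×p real symmetric positive definite matrix with aI ⪯ Θ ⪯ bI. Then λ_max(Θ − ζ(S − Θ⁻¹)) ≤ max(a + ζ/a, b + ζ/b) − ζ·λ_min(S). -/
open Matrix

/-- The quadratic form of `A` at a unit vector is at least `lmin A`. -/
theorem lmin_le_dotProduct_mulVec {n : Type*} [Fintype n] (A : Matrix n n ℝ) {x : n → ℝ}
    (hx : ∑ i, x i ^ 2 = 1) : lmin A ≤ x ⬝ᵥ A *ᵥ x := by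
  refine ciInf_le (f := fun x : {x : n → ℝ // ∑ i, x i ^ 2 = 1} => x.1 ⬝ᵥ A *ᵥ x.1)
    ⟨-∑ i, ∑ j, |A i j|, ?_⟩ ⟨x, hx⟩
  rintro _ ⟨⟨y, hy⟩, rfl⟩
  have hy1 (i : n) : |y i| ≤ 1 := by
    rw [← sq_le_one_iff_abs_le_one, ← hy]
    exact Finset.single_le_sum (f := fun i => y i ^ 2) (fun i _ => sq_nonneg _)
      (Finset.mem_univ i)
  simp only [dotProduct, mulVec, Finset.mul_sum, ← Finset.sum_neg_distrib]
  refine Finset.sum_le_sum fun i _ => Finset.sum_le_sum fun j _ => ?_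
  refine neg_le_of_abs_le ?_
  rw [abs_mul, abs_mul]
  calc |y i| * (|A i j| * |y j|) ≤ 1 * (|A i j| * 1) := by
        gcongr <;> exact hy1 _
    _ = |A i j| := by ring

/-- Matrix form of the scalar inequality `0 ≤ (t - a) * (b - t) / t` for `t ∈ [a, b]`. -/
theorem posSemidef_add_smul_one_sub_sub_smul_inv {n : Type*} [Fintype n] [DecidableEq n]
    {a b : ℝ} (ha : 0 ≤ a) (hab : a < b) {Θ : Matrix n n ℝ} (hΘ : Θ.PosDef)
    (hla : (Θ - a • 1).PosSemidef) (hlb : (b • 1 - Θ).PosSemidef) :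
    ((a + b) • (1 : Matrix n n ℝ) - Θ - (a * b) • Θ⁻¹).PosSemidef := by
  have hR : Θ⁻¹.IsHermitian := hΘ.isHermitian.inv
  have hinv : Θ⁻¹ * Θ = 1 := nonsing_inv_mul _ ((isUnit_iff_isUnit_det _).1 hΘ.isUnit)
  have hU : (b • Θ⁻¹ - 1)ᴴ = b • Θ⁻¹ - 1 := by simp [conjTranspose_sub, conjTranspose_smul, hR.eq, -conjTranspose_eq_transpose_of_trivial]
  have hV : (1 - a • Θ⁻¹)ᴴ = 1 - a • Θ⁻¹ := by simp [conjTranspose_sub, conjTranspose_smul, hR.eq, -conjTranspose_eq_transpose_of_trivial]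
  have h₁ := hla.mul_mul_conjTranspose_same (b • Θ⁻¹ - 1)
  have h₂ := hlb.mul_mul_conjTranspose_same (1 - a • Θ⁻¹)
  have e₁ : (b • Θ⁻¹ - 1) * (Θ - a • 1) = (a + b) • 1 - Θ - (a * b) • Θ⁻¹ := by
    simp only [sub_mul, mul_sub, smul_mul_assoc, mul_smul_comm, hinv, mul_one, one_mul]
    module
  have e₂ : (1 - a • Θ⁻¹) * (b • 1 - Θ) = (a + b) • 1 - Θ - (a * b) • Θ⁻¹ := by
    simp only [sub_mul, mul_sub, smul_mul_assoc, mul_smul_comm, hinv, mul_one, one_mul]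
    module
  rw [hU, e₁] at h₁
  rw [hV, e₂] at h₂
  have hba : 0 < b - a := sub_pos.2 hab
  have h := ((h₁.smul ha).add (h₂.smul (ha.trans hab.le))).smul (inv_nonneg.2 hba.le)
  convert h using 1
  rw [← mul_smul_comm, ← mul_smul_comm, ← mul_add, ← mul_smul_comm]
  have e₃ : (b - a)⁻¹ • (a • (b • Θ⁻¹ - 1) + b • (1 - a • Θ⁻¹)) = (1 : Matrix n n ℝ) := by
    rw [inv_smul_eq_iff₀ hba.ne']
    module
  rw [e₃, mul_one]

/-- A bound on `t + ζ * r` by its endpoint values when `r` lies below the chord of `t ↦ 1 / t`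
over `[a, b]`. -/
theorem add_mul_le_max_of_mem_Icc {a b ζ t r : ℝ} (ha : 0 < a) (hab : a < b) (hζ : 0 ≤ ζ)
    (hat : a ≤ t) (htb : t ≤ b) (hr : a * b * r ≤ a + b - t) :
    t + ζ * r ≤ max (a + ζ / a) (b + ζ / b) := by
  have hb : 0 < b := ha.trans hab
  have hr' : r ≤ (a + b - t) / (a * b) := by
    rw [le_div_iff₀ (mul_pos ha hb)]
    linarith
  have hba : 0 < b - a := sub_pos.2 hab
  have hchord : t + ζ * ((a + b - t) / (a * b)) =
      (b - t) / (b - a) * (a + ζ / a) + (t - a) / (b - a) * (b + ζ / b) := by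
    field_simp
    ring
  calc t + ζ * r ≤ t + ζ * ((a + b - t) / (a * b)) := by gcongr
    _ = (b - t) / (b - a) * (a + ζ / a) + (t - a) / (b - a) * (b + ζ / b) := hchord
    _ ≤ (b - t) / (b - a) * max (a + ζ / a) (b + ζ / b) +
        (t - a) / (b - a) * max (a + ζ / a) (b + ζ / b) := by
      gcongr
      · exact le_max_left _ _
      · exact le_max_right _ _
    _ = max (a + ζ / a) (b + ζ / b) := by
      field_simp
      ring

/-- Upper bound on the largest eigenvalue of the gradient step
`Θ − ζ(S − Θ⁻¹)` when `aI ⪯ Θ ⪯ bI`. -/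
theorem gradient_step_lmax_bound {p : ℕ} (hp : 0 < p)
    (a b ζ : ℝ) (ha : 0 < a) (hab : a < b) (hζ : 0 < ζ)
    (S : Matrix (Fin p) (Fin p) ℝ) (hS : S.IsSymm)
    (Θ : Matrix (Fin p) (Fin p) ℝ) (hΘ : Θ.PosDef)
    (hla : (Θ - a • 1).PosSemidef) (hlb : (b • 1 - Θ).PosSemidef) :
    lmax (Θ - ζ • (S - Θ⁻¹)) ≤ max (a + ζ / a) (b + ζ / b) - ζ * lmin S := by
  have : Nonempty {x : Fin p → ℝ // ∑ i, x i ^ 2 = 1} :=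
    ⟨Pi.single ⟨0, hp⟩ 1, by simp [Pi.single_apply]⟩
  refine ciSup_le fun x => ?_
  have hxx : x.1 ⬝ᵥ x.1 = 1 :=
    (Finset.sum_congr rfl fun i _ => (sq _).symm).trans x.2
  have hb : 0 < b := ha.trans hab
  have hS' : ζ * lmin S ≤ ζ * (x.1 ⬝ᵥ S *ᵥ x.1) :=
    mul_le_mul_of_nonneg_left (lmin_le_dotProduct_mulVec S x.2) hζ.le
  have hta := hla.dotProduct_mulVec_nonneg x.1
  have htb := hlb.dotProduct_mulVec_nonneg x.1
  have hN := (posSemidef_add_smul_one_sub_sub_smul_inv ha.le hab hΘ hla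
    hlb).dotProduct_mulVec_nonneg x.1
  simp only [star_trivial, sub_mulVec, dotProduct_sub, smul_mulVec, one_mulVec, dotProduct_smul,
    smul_eq_mul, hxx, mul_one] at hta htb hN ⊢
  have key := add_mul_le_max_of_mem_Icc ha hab hζ.le (sub_nonneg.1 hta) (sub_nonneg.1 htb)
    (r := x.1 ⬝ᵥ Θ⁻¹ *ᵥ x.1) (by linarith)
  linarith
end

section
/- Let A be a p×p real symmetric matrix and let ε > 0. Then λ_min(η_ε(A)) ≥ λ_min(A) − p·ε. In particular, the soft-thresholded matrix η_ε(A) is positive definite whenever λ_min(A) > p·ε. -/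
open Matrix

lemma abs_softThresh_sub_le {n : Type*} [Fintype n] {c : ℝ} (hc : 0 ≤ c) (A : Matrix n n ℝ)
    (i j : n) : |softThresh c A i j - A i j| ≤ c := by
  simp only [softThresh]
  rcases lt_trichotomy (A i j) 0 with h | h | h
  · rw [Real.sign_of_neg h, abs_of_neg h]
    rcases max_cases (-A i j - c) 0 with ⟨h1, h2⟩ | ⟨h1, h2⟩ <;> rw [h1, abs_le] <;>
      constructor <;> linarith
  · simp [h, hc]
  · rw [Real.sign_of_pos h, abs_of_pos h]
    rcases max_cases (A i j - c) 0 with ⟨h1, h2⟩ | ⟨h1, h2⟩ <;> rw [h1, abs_le] <;>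
      constructor <;> linarith

lemma softThresh_isSymm {n : Type*} [Fintype n] (c : ℝ) {A : Matrix n n ℝ} (hA : A.IsSymm) :
    (softThresh c A).IsSymm := by
  ext i j
  simp [softThresh, hA.apply i j]

/-- A quadratic form whose coefficients are bounded by `c` is at most `c * card n` times the
squared Euclidean norm. -/
lemma abs_dotProduct_mulVec_le {n : Type*} [Fintype n] {c : ℝ} (hc : 0 ≤ c) {B : Matrix n n ℝ}
    (hB : ∀ i j, |B i j| ≤ c) (x : n → ℝ) :
    |x ⬝ᵥ B.mulVec x| ≤ c * (Fintype.card n * ∑ i, x i ^ 2) := by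
  calc |x ⬝ᵥ B.mulVec x| ≤ ∑ i, ∑ j, |x i| * (c * |x j|) := by
        simp only [dotProduct, mulVec, Finset.mul_sum]
        refine (Finset.abs_sum_le_sum_abs _ _).trans (Finset.sum_le_sum fun i _ => ?_)
        refine (Finset.abs_sum_le_sum_abs _ _).trans (Finset.sum_le_sum fun j _ => ?_)
        rw [abs_mul, abs_mul]
        gcongr
        exact hB i j
    _ = c * (∑ i, |x i|) ^ 2 := by
        rw [sq, Finset.sum_mul_sum, Finset.mul_sum]
        refine Finset.sum_congr rfl fun i _ => ?_
        rw [Finset.mul_sum]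
        exact Finset.sum_congr rfl fun j _ => by ring
    _ ≤ c * (Fintype.card n * ∑ i, x i ^ 2) := by
        gcongr
        simpa [sq_abs] using sq_sum_le_card_mul_sum_sq (s := Finset.univ) (f := fun i => |x i|)

lemma bddBelow_rayleigh {n : Type*} [Fintype n] (A : Matrix n n ℝ) :
    BddBelow (Set.range fun x : {x : n → ℝ // ∑ i, (x i) ^ 2 = 1} => x.1 ⬝ᵥ A.mulVec x.1) := by
  have hA : ∀ i j, |A i j| ≤ ∑ i, ∑ j, |A i j| := fun i j =>
    (Finset.single_le_sum (f := fun j => |A i j|) (fun _ _ => abs_nonneg _)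
      (Finset.mem_univ j)).trans
    (Finset.single_le_sum (f := fun i => ∑ j, |A i j|)
      (fun _ _ => Finset.sum_nonneg fun _ _ => abs_nonneg _) (Finset.mem_univ i))
  refine ⟨-((∑ i, ∑ j, |A i j|) * (Fintype.card n * 1)), ?_⟩
  rintro _ ⟨⟨x, hx⟩, rfl⟩
  have h := abs_dotProduct_mulVec_le
    (Finset.sum_nonneg fun _ _ => Finset.sum_nonneg fun _ _ => abs_nonneg _) hA x
  rw [hx] at h
  exact neg_le_of_abs_le h

lemma lmin_mul_sum_sq_le {n : Type*} [Fintype n] (A : Matrix n n ℝ) (x : n → ℝ) :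
    lmin A * ∑ i, x i ^ 2 ≤ x ⬝ᵥ A.mulVec x := by
  have hs : 0 ≤ ∑ i, x i ^ 2 := Finset.sum_nonneg fun _ _ => sq_nonneg _
  rcases hs.eq_or_lt with h | h
  · have hx : x = 0 := by
      ext i
      simpa using (Finset.sum_eq_zero_iff_of_nonneg fun i _ => sq_nonneg (x i)).1 h.symm i
        (Finset.mem_univ i)
    simp [hx]
  · set r := Real.sqrt (∑ i, x i ^ 2) with hr
    have hr2 : r ^ 2 = ∑ i, x i ^ 2 := Real.sq_sqrt hs
    have hr0 : 0 < r := Real.sqrt_pos.2 h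
    have hunit : ∑ i, (r⁻¹ • x) i ^ 2 = 1 := by
      simp only [Pi.smul_apply, smul_eq_mul, mul_pow, ← Finset.mul_sum, ← hr2]
      field_simp
    have hle : lmin A ≤ (r⁻¹ • x) ⬝ᵥ A.mulVec (r⁻¹ • x) :=
      ciInf_le (bddBelow_rayleigh A) ⟨r⁻¹ • x, hunit⟩
    rw [mulVec_smul, dotProduct_smul, smul_dotProduct, smul_eq_mul, smul_eq_mul] at hle
    rw [← hr2]
    calc lmin A * r ^ 2 ≤ (r⁻¹ * (r⁻¹ * (x ⬝ᵥ A.mulVec x))) * r ^ 2 := by gcongr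
      _ = x ⬝ᵥ A.mulVec x := by field_simp

lemma lmin_sub_mul_sum_sq_le_softThresh {n : Type*} [Fintype n] {c : ℝ} (hc : 0 ≤ c)
    (A : Matrix n n ℝ) (x : n → ℝ) :
    (lmin A - Fintype.card n * c) * ∑ i, x i ^ 2 ≤ x ⬝ᵥ (softThresh c A).mulVec x := by
  have h1 := lmin_mul_sum_sq_le A x
  have h2 := neg_le_of_abs_le (abs_dotProduct_mulVec_le (B := softThresh c A - A) hc
    (abs_softThresh_sub_le hc A) x)
  rw [sub_mulVec, dotProduct_sub] at h2
  linarith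

/-- Soft-thresholding decreases the smallest eigenvalue of a symmetric matrix
by at most `pε`; in particular `η_ε(A)` is positive definite whenever
`λmin(A) > pε`. -/
theorem softThresh_lmin_bound {p : ℕ} (hp : 0 < p)
    (A : Matrix (Fin p) (Fin p) ℝ) (hA : A.IsSymm) (ε : ℝ) (hε : 0 < ε) :
    lmin A - p * ε ≤ lmin (softThresh ε A) ∧
    (p * ε < lmin A → (softThresh ε A).PosDef) := by
  have key := lmin_sub_mul_sum_sq_le_softThresh hε.le A
  rw [Fintype.card_fin] at key
  refine ⟨?_, fun h => ?_⟩
  · have : Nonempty {x : Fin p → ℝ // ∑ i, (x i) ^ 2 = 1} :=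
      ⟨⟨Pi.single ⟨0, hp⟩ 1, by simp [Pi.single_apply]⟩⟩
    refine le_ciInf fun x => ?_
    simpa [x.2] using key x.1
  · refine PosDef.of_dotProduct_mulVec_pos ?_ fun {x} hx => ?_
    · rw [IsHermitian, conjTranspose_eq_transpose_of_trivial]
      exact softThresh_isSymm ε hA
    · rw [star_trivial]
      obtain ⟨i, hi⟩ := Function.ne_iff.1 hx
      have hs : 0 < ∑ i, x i ^ 2 :=
        Finset.sum_pos' (fun _ _ => sq_nonneg _) ⟨i, Finset.mem_univ i, sq_pos_of_ne_zero hi⟩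
      exact (mul_pos (sub_pos.2 h) hs).trans_le (key x)
end
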